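/- arXiv:1712.02523 — 3 statements merged into one kernel-verified Lean document; each statement's English description precedes it below -/
import Mathlib

section
/- Let C be a locally presentable category and J a set of morphisms of C. Then there exist a regular cardinal λ and a monad T on C which preserves λ-filtered colimits, such that an object X of C admits a T-algebra structure (i.e., there exists a T-algebra whose underlying object is X) if and only if X is J-injective; moreover the category of T-algebras is locally presentable. -/
open CategoryTheory Limits

universe v u

/-- A small category `J` is `κ`-filtered if every diagram in `J` indexed by a small category
with fewer than `κ` arrows admits a cocone. -/
def IsCardinalFilteredCat (κ : Cardinal.{v}) (J : Cat.{v, v}) : Prop :=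
  ∀ A : Cat.{v, v}, Cardinal.mk (Arrow A) < κ → ∀ F : A ⥤ J, Nonempty (Cocone F)

/-- An object `X` of `C` is `κ`-presentable if `Hom(X, -)` preserves colimits indexed by any
`κ`-filtered small category. -/
def IsCardinalPresentableObj (κ : Cardinal.{v}) {C : Type u} [Category.{v} C] (X : C) : Prop :=
  ∀ J : Cat.{v, v}, IsCardinalFilteredCat κ J →
    Nonempty (PreservesColimitsOfShape J (coyoneda.obj (Opposite.op X)))

/-- A category has `κ`-filtered colimits if it has colimits of every `κ`-filtered small shape. -/
def HasCardinalFilteredColimits (κ : Cardinal.{v}) (C : Type u) [Category.{v} C] : Prop :=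
  ∀ J : Cat.{v, v}, IsCardinalFilteredCat κ J → HasColimitsOfShape J C

/-- A category is `κ`-accessible if `κ` is regular, it has `κ`-filtered colimits, and it has a
small set of `κ`-presentable objects of which every object is a `κ`-filtered colimit. -/
structure IsCardinalAccessibleCat (κ : Cardinal.{v}) (C : Type u) [Category.{v} C] : Prop where
  regular : κ.IsRegular
  hasFilteredColimits : HasCardinalFilteredColimits κ C
  exists_generators : ∃ S : Set C, Small.{v} (↥S) ∧ (∀ X ∈ S, IsCardinalPresentableObj κ X) ∧
    ∀ X : C, ∃ J : Cat.{v, v}, IsCardinalFilteredCat κ J ∧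
      ∃ F : J ⥤ C, (∀ j : J, F.obj j ∈ S) ∧
        ∃ c : Cocone F, Nonempty (IsColimit c) ∧ Nonempty (c.pt ≅ X)

/-- A category is accessible if it is `κ`-accessible for some regular cardinal `κ`. -/
def IsAccessibleCat (C : Type u) [Category.{v} C] : Prop :=
  ∃ κ : Cardinal.{v}, IsCardinalAccessibleCat κ C

/-- A category is locally presentable if it is accessible and cocomplete. -/
def IsLocallyPresentableCat (C : Type u) [Category.{v} C] : Prop :=
  IsAccessibleCat C ∧ HasColimitsOfSize.{v, v} C

/-- A full subcategory (given by a set of objects `A`) is closed under `κ`-filtered colimits if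
the colimit of any `κ`-filtered diagram with values in `A` again lies in `A`. -/
def ClosedUnderCardinalFilteredColimits (κ : Cardinal.{v}) {C : Type u} [Category.{v} C]
    (A : Set C) : Prop :=
  ∀ J : Cat.{v, v}, IsCardinalFilteredCat κ J → ∀ F : J ⥤ C, (∀ j : J, F.obj j ∈ A) →
    ∀ c : Cocone F, IsColimit c → c.pt ∈ A

/-- A full subcategory (given by a set of objects `A`) is closed under small products. -/
def ClosedUnderSmallProducts {C : Type u} [Category.{v} C] (A : Set C) : Prop :=
  ∀ (ι : Type v) (X : ι → C), (∀ i, X i ∈ A) → ∀ c : Fan X, IsLimit c → c.pt ∈ A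

open Opposite

section AlgebraicInjectives

variable {C : Type u} [Category.{v} C] {ι : Type v} {P Q : ι → C}

/-- An algebraic injective: an object with a chosen extension along `j i` of every morphism
out of `P i`. -/
structure AlgInj (j : ∀ i, P i ⟶ Q i) where
  /-- The underlying object. -/
  obj : C
  /-- The chosen extensions. -/
  extend : ∀ i, (P i ⟶ obj) → (Q i ⟶ obj)
  fac : ∀ i (h : P i ⟶ obj), j i ≫ extend i h = h

namespace AlgInj

variable {j : ∀ i, P i ⟶ Q i}

/-- Morphisms of algebraic injectives preserve the chosen extensions. -/
@[ext]
structure Hom (X Y : AlgInj j) where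
  /-- The underlying morphism. -/
  hom : X.obj ⟶ Y.obj
  extend_comp : ∀ i (h : P i ⟶ X.obj), X.extend i h ≫ hom = Y.extend i (h ≫ hom)

instance : Category.{v} (AlgInj j) where
  Hom := Hom
  id X := { hom := 𝟙 _, extend_comp := by simp }
  comp f g :=
    { hom := f.hom ≫ g.hom
      extend_comp := fun i h => by
        rw [← Category.assoc, f.extend_comp, g.extend_comp, Category.assoc] }

@[ext]
lemma hom_ext {X Y : AlgInj j} {f g : X ⟶ Y} (h : f.hom = g.hom) : f = g := Hom.ext h

variable (j) in
/-- The forgetful functor from algebraic injectives. -/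
@[simps]
def forget : AlgInj j ⥤ C where
  obj X := X.obj
  map f := f.hom

instance : (forget j).Faithful where
  map_injective h := hom_ext h

instance : (forget j).ReflectsIsomorphisms where
  reflects f hf := by
    have : IsIso f.hom := hf
    exact ⟨{ hom := inv f.hom, extend_comp := fun i h => by simp [f.extend_comp] },
      hom_ext (IsIso.hom_inv_id f.hom), hom_ext (IsIso.inv_hom_id f.hom)⟩

section Split

variable {X Y : AlgInj j} {f g : X ⟶ Y} {Z : C} {π : Y.obj ⟶ Z}

lemma extend_comp_splitCoequalizer (q : IsSplitCoequalizer f.hom g.hom π) (i : ι)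
    (h : P i ⟶ Y.obj) :
    Y.extend i (h ≫ π ≫ q.rightSection) ≫ π = Y.extend i h ≫ π := by
  rw [← q.leftSection_top, ← Category.assoc h, ← f.extend_comp, Category.assoc, q.condition,
    ← Category.assoc, g.extend_comp, Category.assoc, q.leftSection_bottom, Category.comp_id]

variable (q : IsSplitCoequalizer f.hom g.hom π)

/-- The target of a split coequalizer of underlying morphisms is an algebraic injective. -/
@[simps]
def splitCoequalizer : AlgInj j where
  obj := Z
  extend i h := Y.extend i (h ≫ q.rightSection) ≫ π
  fac i h := by rw [← Category.assoc, Y.fac, Category.assoc, q.rightSection_π, Category.comp_id]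

/-- The projection to `splitCoequalizer`. -/
@[simps]
def splitCoequalizerπ : Y ⟶ splitCoequalizer q where
  hom := π
  extend_comp i h := by
    change _ = Y.extend i ((h ≫ π) ≫ q.rightSection) ≫ π
    rw [Category.assoc]
    exact (extend_comp_splitCoequalizer q i h).symm

/-- `splitCoequalizer q` is a coequalizer of `f` and `g`. -/
def isColimitSplitCoequalizer :
    IsColimit (Cofork.ofπ (f := f) (g := g) (splitCoequalizerπ q) (hom_ext q.condition)) :=
  have key (s : Cofork f g) : π ≫ q.rightSection ≫ s.π.hom = s.π.hom := by
    have := congrArg Hom.hom s.condition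
    change f.hom ≫ s.π.hom = g.hom ≫ s.π.hom at this
    rw [← Category.assoc, ← q.leftSection_top, Category.assoc, this, ← Category.assoc,
      q.leftSection_bottom, Category.id_comp]
  Cofork.IsColimit.mk _
    (fun s =>
      { hom := q.rightSection ≫ s.π.hom
        extend_comp := fun i h => by
          change (Y.extend i (h ≫ q.rightSection) ≫ π) ≫ q.rightSection ≫ s.π.hom =
            s.pt.extend i (h ≫ q.rightSection ≫ s.π.hom)
          rw [Category.assoc, key, s.π.extend_comp]
          exact congrArg (s.pt.extend i) (Category.assoc h q.rightSection s.π.hom) })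
    (fun s => hom_ext (key s))
    (fun s m hm => hom_ext (by
      have := congrArg (q.rightSection ≫ ·) (congrArg Hom.hom hm)
      change q.rightSection ≫ π ≫ m.hom = q.rightSection ≫ s.π.hom at this
      exact (q.rightSection_π_assoc m.hom).symm.trans this))

end Split

instance : Monad.PreservesColimitOfIsSplitPair (forget j) where
  out f g _ := by
    let q : IsSplitCoequalizer f.hom g.hom _ :=
      HasSplitCoequalizer.isSplitCoequalizer ((forget j).map f) ((forget j).map g)
    exact preservesColimit_of_preserves_colimit_cocone (isColimitSplitCoequalizer q)
      ((isColimitMapCoconeCoforkEquiv (forget j) _).symm q.isCoequalizer)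

instance : Monad.HasCoequalizerOfIsSplitPair (forget j) where
  out f g _ :=
    let q : IsSplitCoequalizer f.hom g.hom _ :=
      HasSplitCoequalizer.isSplitCoequalizer ((forget j).map f) ((forget j).map g)
    ⟨⟨_, isColimitSplitCoequalizer q⟩⟩

end AlgInj

variable (Q) in
/-- The category of objects `X` equipped with a family of sets of maps `Q i ⟶ X`
(indexed by arbitrary types). -/
abbrev Partial : Type _ :=
  Comma (𝟭 (ι → Type v)) (Functor.pi' fun i => coyoneda.obj (op (Q i)))

namespace Partial

section

variable {K : Type v} [SmallCategory K]

instance (i : ι) : PreservesColimitsOfShape K (Pi.eval (fun _ : ι => Type v) i) where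
  preservesColimit {F} :=
    preservesColimit_of_preserves_colimit_cocone
      (pi.coconeOfCoconeEvalIsColimit
        (fun i => colimit.isColimit (F ⋙ Pi.eval (fun _ : ι => Type v) i)))
      (colimit.isColimit (F ⋙ Pi.eval (fun _ : ι => Type v) i))

instance : HasColimitsOfShape K (ι → Type v) where
  has_colimit _ := pi.hasColimit_of_hasColimit_comp_eval

end

variable {i : ι}

/-- The map `Q i ⟶ X.right` labelled by `s`. -/
def val (X : Partial Q) (s : X.left i) : Q i ⟶ X.right :=
  (X.hom i : X.left i → (Q i ⟶ X.right)) s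

lemma val_comp {X Y : Partial Q} (f : X ⟶ Y) (s : X.left i) :
    X.val s ≫ f.right = Y.val ((f.left i : X.left i → Y.left i) s) :=
  (ConcreteCategory.congr_hom (congrFun f.w i) s).symm

variable (Q) in
/-- The object `X` equipped with no maps. -/
def free (X : C) : Partial Q where
  left _ := PEmpty
  right := X
  hom _ := ↾PEmpty.elim

/-- Morphisms from `free Q X` are morphisms from `X`. -/
def freeHomEquiv (X : C) (Y : Partial Q) : (free Q X ⟶ Y) ≃ (X ⟶ Y.right) where
  toFun f := f.right
  invFun f :=
    { left := fun _ => ↾PEmpty.elim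
      right := f
      w := by ext i ⟨⟩ }
  left_inv f := by
    ext i x
    · cases x
    · rfl
  right_inv f := rfl

variable (Q) in
/-- The object `Q i` equipped with its identity. -/
def generic (i : ι) : Partial Q where
  left k := ULift (PLift (i = k))
  right := Q i
  hom k := ↾fun h => eqToHom (by rw [h.down.down])

/-- Morphisms from `generic Q i` to `Y` are elements of `Y.left i`. -/
def genericHomEquiv (i : ι) (Y : Partial Q) : (generic Q i ⟶ Y) ≃ Y.left i where
  toFun f := (f.left i : ULift (PLift (i = i)) → Y.left i) ⟨⟨rfl⟩⟩
  invFun s :=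
    { left := fun k => ↾fun (h : ULift (PLift (i = k))) => h.down.down ▸ s
      right := Y.val s
      w := by
        ext k ⟨⟨h⟩⟩
        subst h
        exact (Category.id_comp (Y.val s)).symm }
  left_inv f := by
    ext k x
    · obtain ⟨⟨h⟩⟩ := x
      subst h
      rfl
    · exact (val_comp f ⟨⟨rfl⟩⟩).symm.trans (Category.id_comp f.right)
  right_inv s := rfl

section Presentable

variable [HasColimitsOfSize.{v, v} C] (κ : Cardinal.{v}) [Fact κ.IsRegular]

instance (X : C) [IsCardinalPresentable X κ] : IsCardinalPresentable (free Q X) κ where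
  preservesColimitOfShape K _ _ := by
    have := Functor.preservesColimitsOfShape_of_isCardinalAccessible (coyoneda.obj (op X)) κ K
    let e : Comma.snd (𝟭 (ι → Type v)) (Functor.pi' fun i => coyoneda.obj (op (Q i))) ⋙
        coyoneda.obj (op X) ≅ coyoneda.obj (op (free Q X)) :=
      NatIso.ofComponents (fun Y => (freeHomEquiv X Y).symm.toIso) (fun f => by
        ext g
        exact (freeHomEquiv X _).injective rfl)
    exact preservesColimitsOfShape_of_natIso e

instance (i : ι) : IsCardinalPresentable (generic Q i) κ where
  preservesColimitOfShape K _ _ := by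
    let e : coyoneda.obj (op (generic Q i)) ≅
        Comma.fst (𝟭 (ι → Type v)) (Functor.pi' fun i => coyoneda.obj (op (Q i))) ⋙
          Pi.eval _ i :=
      NatIso.ofComponents (fun Y => (genericHomEquiv i Y).toIso) (fun f => by
        ext g
        rfl)
    exact preservesColimitsOfShape_of_natIso e.symm

end Presentable

/-- The morphisms to which algebraic injectives are orthogonal. -/
def lifting (j : ∀ i, P i ⟶ Q i) : MorphismProperty (Partial Q) :=
  .ofHoms fun i => (freeHomEquiv (P i) (generic Q i)).symm (j i)

instance (j : ∀ i, P i ⟶ Q i) : MorphismProperty.IsSmall.{v} (lifting j) := by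
  unfold lifting
  infer_instance

lemma isLocal_lifting_iff (j : ∀ i, P i ⟶ Q i) (X : Partial Q) :
    (lifting j).isLocal X ↔ ∀ i, Function.Bijective fun s : X.left i => j i ≫ X.val s := by
  have key (i : ι) : (fun s : X.left i => j i ≫ X.val s) = freeHomEquiv (P i) X ∘
      (fun g => (freeHomEquiv (P i) (generic Q i)).symm (j i) ≫ g) ∘
        (genericHomEquiv i X).symm := rfl
  simp only [key, EquivLike.comp_bijective, EquivLike.bijective_comp]
  exact ⟨fun h i => h _ ⟨i⟩, fun h _ _ _ ⟨i⟩ => h i⟩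

end Partial

namespace AlgInj

variable {j : ∀ i, P i ⟶ Q i}

variable (j) in
/-- Algebraic injectives as objects equipped with maps from the `Q i`. -/
def toPartial : AlgInj j ⥤ Partial Q where
  obj X :=
    { left := fun i => P i ⟶ X.obj
      right := X.obj
      hom := fun i => ↾(X.extend i) }
  map f :=
    { left := fun i => ↾(· ≫ f.hom)
      right := f.hom
      w := by
        ext i h
        exact (f.extend_comp i h).symm }
  map_id X := by
    ext i h
    · exact Category.comp_id h
    · rfl
  map_comp f g := by
    ext i h
    · exact (Category.assoc h f.hom g.hom).symm
    · rfl

instance : (toPartial j).Faithful where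
  map_injective h := hom_ext (congrArg CommaMorphism.right h)

lemma left_toPartial {X Y : AlgInj j} (g : (toPartial j).obj X ⟶ (toPartial j).obj Y) {i : ι}
    (h : P i ⟶ X.obj) :
    (g.left i : (P i ⟶ X.obj) → (P i ⟶ Y.obj)) h = h ≫ g.right := by
  let r : X.obj ⟶ Y.obj := g.right
  let k : P i ⟶ Y.obj := (g.left i : (P i ⟶ X.obj) → (P i ⟶ Y.obj)) h
  calc
    k = j i ≫ Y.extend i k := (Y.fac i k).symm
    _ = j i ≫ X.extend i h ≫ r := congrArg (j i ≫ ·) (Partial.val_comp g h).symm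
    _ = h ≫ r := by rw [← Category.assoc, X.fac]

instance : (toPartial j).Full where
  map_surjective {X Y} g := by
    refine ⟨{ hom := g.right, extend_comp := fun i h => ?_ }, ?_⟩
    · exact (Partial.val_comp g h).trans (congrArg (Y.extend i) (left_toPartial g h))
    · ext i h
      · exact (left_toPartial g h).symm
      · rfl

lemma isLocal_toPartial (X : AlgInj j) : (Partial.lifting j).isLocal ((toPartial j).obj X) := by
  rw [Partial.isLocal_lifting_iff]
  intro i
  have : (fun h : P i ⟶ X.obj => j i ≫ X.extend i h) = id := funext (X.fac i)
  exact this ▸ Function.bijective_id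

variable (j) in
/-- The comparison of algebraic injectives with an orthogonality class. -/
abbrev toLocal : AlgInj j ⥤ (Partial.lifting j).isLocal.FullSubcategory :=
  (Partial.lifting j).isLocal.lift (toPartial j) isLocal_toPartial

instance : (toLocal j).EssSurj where
  mem_essImage Y := by
    have hY := (Partial.isLocal_lifting_iff j Y.obj).1 Y.property
    let e i := Equiv.ofBijective _ (hY i)
    let X : AlgInj j :=
      { obj := Y.obj.right
        extend := fun i h => Y.obj.val ((e i).symm h)
        fac := fun i h => (e i).apply_symm_apply h }
    refine ⟨X, ⟨(ObjectProperty.fullyFaithfulι _).preimageIso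
      (Comma.isoMk (Pi.isoMk fun i => (e i).symm.toIso) (Iso.refl _) ?_)⟩⟩
    ext i h
    exact (Category.comp_id _).symm

instance : (toLocal j).IsEquivalence where

variable (j) in
/-- The forgetful functor as a composition of right adjoints. -/
def forgetIso : toLocal j ⋙ (Partial.lifting j).isLocal.ι ⋙ Comma.snd _ _ ≅ forget j :=
  NatIso.ofComponents (fun _ => Iso.refl _) (fun f =>
    (Category.comp_id f.hom).trans (Category.id_comp f.hom).symm)

instance : (Comma.snd (𝟭 (ι → Type v))
    (Functor.pi' fun i => coyoneda.obj (op (Q i)))).IsRightAdjoint :=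
  (Adjunction.adjunctionOfEquivLeft (G := Comma.snd (𝟭 (ι → Type v))
    (Functor.pi' fun i => coyoneda.obj (op (Q i)))) (F_obj := Partial.free Q)
      (fun X Y => Partial.freeHomEquiv X Y) (fun _ _ _ _ _ => rfl)).isRightAdjoint

instance : HasColimitsOfSize.{v, v} (ι → Type v) where

lemma isCardinalPresentable_lifting [HasColimitsOfSize.{v, v} C] (κ : Cardinal.{v})
    [Fact κ.IsRegular] [∀ i, IsCardinalPresentable (P i) κ] ⦃X Y : Partial Q⦄
    (f : X ⟶ Y) (hf : Partial.lifting j f) :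
    IsCardinalPresentable X κ ∧ IsCardinalPresentable Y κ := by
  obtain ⟨i⟩ := hf
  exact ⟨inferInstance, inferInstance⟩

lemma isRightAdjoint_ι (j : ∀ i, P i ⟶ Q i)
    [HasColimitsOfSize.{v, v} C] (κ : Cardinal.{v}) [Fact κ.IsRegular]
    [∀ i, IsCardinalPresentable (P i) κ] : (Partial.lifting j).isLocal.ι.IsRightAdjoint :=
  (Partial.lifting j).isRightAdjoint_ι_isLocal κ (isCardinalPresentable_lifting κ)

lemma isRightAdjoint_forget (j : ∀ i, P i ⟶ Q i)
    [HasColimitsOfSize.{v, v} C] (κ : Cardinal.{v}) [Fact κ.IsRegular]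
    [∀ i, IsCardinalPresentable (P i) κ] : (forget j).IsRightAdjoint :=
  have := isRightAdjoint_ι j κ
  Functor.isRightAdjoint_of_iso (forgetIso j)

lemma hasColimits (j : ∀ i, P i ⟶ Q i)
    [HasColimitsOfSize.{v, v} C] (κ : Cardinal.{v}) [Fact κ.IsRegular]
    [∀ i, IsCardinalPresentable (P i) κ] : HasColimitsOfSize.{v, v} (AlgInj j) :=
  have := isRightAdjoint_ι j κ
  let : Reflective (Partial.lifting j).isLocal.ι := ⟨_, Adjunction.ofIsRightAdjoint _⟩
  have := hasColimits_of_reflective (Partial.lifting j).isLocal.ι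
  Adjunction.has_colimits_of_equivalence (toLocal j)

lemma isCardinalAccessible_forget (j : ∀ i, P i ⟶ Q i)
    [HasColimitsOfSize.{v, v} C] (κ : Cardinal.{v}) [Fact κ.IsRegular]
    [∀ i, IsCardinalPresentable (P i) κ] : (forget j).IsCardinalAccessible κ where
  preservesColimitOfShape K _ _ := by
    have := (Partial.lifting j).isCardinalAccessible_ι_isLocal κ (isCardinalPresentable_lifting κ)
    have := Functor.preservesColimitsOfShape_of_isCardinalAccessible
      (Partial.lifting j).isLocal.ι κ K
    exact preservesColimitsOfShape_of_natIso (forgetIso j)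

end AlgInj

end AlgebraicInjectives

/-- If a faithful conservative functor has a left adjoint, the latter maps strong generators to
strong generators. -/
lemma CategoryTheory.Adjunction.isStrongGenerator_strictMap {C D : Type*}
    [Category* C] [Category* D] {F : C ⥤ D} {G : D ⥤ C} (adj : F ⊣ G)
    [G.Faithful] [G.ReflectsIsomorphisms]
    {S : ObjectProperty C} (hS : S.IsStrongGenerator) : (S.strictMap F).IsStrongGenerator := by
  rw [ObjectProperty.isStrongGenerator_iff]
  refine ⟨fun X Y f g h => G.map_injective (hS.isSeparating _ _ fun A hA a => ?_),
    fun X Y i _ hi => ?_⟩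
  · have := h (F.obj A) (S.strictMap_obj F hA) ((adj.homEquiv A X).symm a)
    rw [← adj.homEquiv_naturality_right_symm, ← adj.homEquiv_naturality_right_symm] at this
    exact (adj.homEquiv _ _).symm.injective this
  · have := adj.isRightAdjoint
    have : IsIso (G.map i) := hS.isIso_of_mono _ fun A hA a => by
      obtain ⟨b, hb⟩ := hi (F.obj A) (S.strictMap_obj F hA) ((adj.homEquiv A Y).symm a)
      refine ⟨adj.homEquiv _ _ b, ?_⟩
      dsimp only at hb ⊢
      rw [← adj.homEquiv_naturality_right, hb, Equiv.apply_symm_apply]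
    exact isIso_of_reflects_iso i G

section Comparison

variable {C : Type u} [Category.{v} C] {κ : Cardinal.{v}}

lemma isCardinalFilteredCat_iff [Fact κ.IsRegular] (J : Cat.{v, v}) :
    IsCardinalFilteredCat κ J ↔ IsCardinalFiltered J κ :=
  ⟨fun h => ⟨fun {A} _ F hA =>
      h (Cat.of A) ((hasCardinalLT_iff_cardinal_mk_lt _ _).1 hA) F⟩,
    fun _ _ hA F => IsCardinalFiltered.nonempty_cocone F
      ((hasCardinalLT_iff_cardinal_mk_lt _ _).2 hA)⟩

lemma isCardinalPresentableObj_iff [Fact κ.IsRegular] (X : C) :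
    IsCardinalPresentableObj κ X ↔ IsCardinalPresentable X κ :=
  ⟨fun h => ⟨fun J _ _ =>
      (h (Cat.of J) ((isCardinalFilteredCat_iff (Cat.of J)).2 ‹_›)).some⟩,
    fun _ J hJ =>
      have := (isCardinalFilteredCat_iff J).1 hJ
      ⟨Functor.preservesColimitsOfShape_of_isCardinalAccessible _ κ J⟩⟩

lemma IsCardinalAccessibleCat.hasCardinalFilteredGenerator [Fact κ.IsRegular]
    (h : IsCardinalAccessibleCat κ C) : HasCardinalFilteredGenerator C κ := by
  obtain ⟨S, hS, hS₁, hS₂⟩ := h.exists_generators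
  let R : ObjectProperty C := fun X => X ∈ S
  have : ObjectProperty.Small.{v} R := hS
  refine ObjectProperty.IsCardinalFilteredGenerator.hasCardinalFilteredGenerator (P := R)
    ⟨fun X hX => (isCardinalPresentableObj_iff X).1 (hS₁ X hX), fun X => ?_⟩
  obtain ⟨J, hJ, F, hF, c, ⟨hc⟩, ⟨e⟩⟩ := hS₂ X
  exact ⟨J, inferInstance, (isCardinalFilteredCat_iff J).1 hJ,
    ⟨{ diag := F
       ι := (c.extend e.hom).ι
       isColimit := IsColimit.ofIsoColimit hc (c.extendIso e)
       prop_diag_obj := hF }⟩⟩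

lemma isLocallyPresentableCat_of_isCardinalLocallyPresentable [Fact κ.IsRegular]
    [IsCardinalLocallyPresentable C κ] : IsLocallyPresentableCat C := by
  refine ⟨⟨κ, Fact.out, fun J _ => inferInstance, ?_⟩, inferInstance⟩
  obtain ⟨S, hS, hS'⟩ := HasCardinalFilteredGenerator.exists_small_generator C κ
  refine ⟨{X | S X}, hS, fun X hX =>
    (isCardinalPresentableObj_iff X).2 (hS'.le_isCardinalPresentable X hX), fun X => ?_⟩
  obtain ⟨J, _, hJ, ⟨p⟩⟩ := hS'.exists_colimitsOfShape X
  exact ⟨Cat.of J, (isCardinalFilteredCat_iff (Cat.of J)).2 hJ, p.diag, p.prop_diag_obj,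
    _, ⟨p.isColimit⟩, ⟨Iso.refl _⟩⟩

lemma exists_isCardinalLocallyPresentable_and_isCardinalPresentable
    (hC : IsLocallyPresentableCat C) {ι : Type v} (P : ι → C) :
    ∃ (κ : Cardinal.{v}) (_ : Fact κ.IsRegular), IsCardinalLocallyPresentable C κ ∧
      ∀ i, IsCardinalPresentable (P i) κ := by
  obtain ⟨⟨κ, hκ⟩, _⟩ := hC
  have : Fact κ.IsRegular := ⟨hκ.regular⟩
  have := hκ.hasCardinalFilteredGenerator
  have : IsCardinalLocallyPresentable C κ := { }
  have : IsLocallyPresentable.{v} C := ⟨κ, ‹_›, ‹_›⟩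
  choose μ hμ hP using fun i =>
    Functor.IsAccessible.exists_cardinal.{v} (F := coyoneda.obj (op (P i)))
  obtain ⟨lam, hlam, h⟩ := HasCardinalLT.exists_regular_cardinal_forall.{v}
    (fun o : Option ι => (o.elim κ μ).ord.ToType)
  have hle (o : Option ι) : o.elim κ μ ≤ lam :=
    le_of_lt (by simpa [hasCardinalLT_iff_cardinal_mk_lt] using h o)
  have : Fact lam.IsRegular := ⟨hlam⟩
  have h₀ : κ ≤ lam := hle none
  have h₁ (i : ι) : μ i ≤ lam := hle (some i)
  refine ⟨lam, ‹_›, .of_le C h₀, fun i => ?_⟩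
  have := hμ i
  have : IsCardinalPresentable (P i) (μ i) := hP i
  exact isCardinalPresentable_of_le _ (h₁ i)

end Comparison

/-- For a set `J` of morphisms of a locally presentable category `C`, there is a
regular cardinal `λ` and a monad `T` on `C` preserving `λ`-filtered colimits such that an object
admits a `T`-algebra structure iff it is `J`-injective; moreover the category of `T`-algebras is
locally presentable. -/
theorem exists_accessible_monad_detecting_injectives
    {C : Type u} [Category.{v} C] (hC : IsLocallyPresentableCat C)
    {ι : Type v} (P Q : ι → C) (j : ∀ i, P i ⟶ Q i) :
    ∃ lam : Cardinal.{v}, lam.IsRegular ∧ ∃ T : Monad C,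
      (∀ J : Cat.{v, v}, IsCardinalFilteredCat lam J →
        Nonempty (PreservesColimitsOfShape J T.toFunctor)) ∧
      (∀ X : C,
        (∃ a : T.obj X ⟶ X, T.η.app X ≫ a = 𝟙 X ∧ T.μ.app X ≫ a = T.map a ≫ a) ↔
          ∀ (i : ι) (h : P i ⟶ X), ∃ g : Q i ⟶ X, j i ≫ g = h) ∧
      IsLocallyPresentableCat (Monad.Algebra T) := by
  obtain ⟨κ, hκ, _, _⟩ := exists_isCardinalLocallyPresentable_and_isCardinalPresentable hC P
  have := AlgInj.isRightAdjoint_forget j κ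
  have := AlgInj.hasColimits j κ
  have := AlgInj.isCardinalAccessible_forget j κ
  let adj := Adjunction.ofIsRightAdjoint (AlgInj.forget j)
  refine ⟨κ, Fact.out, adj.toMonad, fun K hK => ?_, fun X => ⟨?_, fun h => ?_⟩, ?_⟩
  · have := (isCardinalFilteredCat_iff K).1 hK
    have := Functor.preservesColimitsOfShape_of_isCardinalAccessible (AlgInj.forget j) κ K
    exact ⟨inferInstanceAs <| PreservesColimitsOfShape K
      ((AlgInj.forget j).leftAdjoint ⋙ AlgInj.forget j)⟩
  · rintro ⟨a, ha, -⟩ i h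
    let Y := (AlgInj.forget j).leftAdjoint.obj X
    let η : X ⟶ Y.obj := adj.unit.app X
    let b : Y.obj ⟶ X := a
    have hb : η ≫ b = 𝟙 X := ha
    exact ⟨Y.extend i (h ≫ η) ≫ b, by
      rw [← Category.assoc, Y.fac, Category.assoc, hb, Category.comp_id]⟩
  · choose e he using h
    let A := (Monad.comparison adj).obj ⟨X, e, he⟩
    exact ⟨A.a, A.unit, A.assoc⟩
  · have : IsCardinalLocallyPresentable (AlgInj j) κ := by
      obtain ⟨S, _, hS, hS'⟩ :=
        (IsCardinalLocallyPresentable.iff_exists_isStrongGenerator C κ).1 inferInstance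
      rw [IsCardinalLocallyPresentable.iff_exists_isStrongGenerator]
      refine ⟨S.strictMap (AlgInj.forget j).leftAdjoint, inferInstance,
        adj.isStrongGenerator_strictMap hS, ?_⟩
      rintro _ ⟨X, hX⟩
      have : IsCardinalPresentable X κ := hS' X hX
      exact adj.isCardinalPresentable_leftAdjoint_obj κ X
    let := Monad.monadicOfHasPreservesGSplitCoequalizersOfReflectsIsomorphisms adj
    have : (Monad.comparison adj).IsEquivalence :=
      MonadicRightAdjoint.eqv (R := AlgInj.forget j)
    have := (Monad.comparison adj).asEquivalence.isCardinalLocallyPresentable κ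
    exact isLocallyPresentableCat_of_isCardinalLocallyPresentable (κ := κ)
end

section
/- Let R be a commutative ring. There exists a monad T on the arrow category of the category of unbounded chain complexes of R-modules such that an object f of the arrow category (i.e., a chain map f : X ⟶ Y) admits a T-algebra structure if and only if f is a quasi-isomorphism. -/
open CategoryTheory

namespace QuasiIsoMonad

universe u

variable {R : Type u} [CommRing R]

/-- The source (`true`) or the target (`false`) of an arrow of chain complexes. -/
abbrev side (f : Arrow (ChainComplex (ModuleCat.{u} R) ℤ)) :
    Bool → ChainComplex (ModuleCat.{u} R) ℤ
  | true => f.left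
  | false => f.right

/-- The component of a morphism of arrows at the source or at the target. -/
def sideMap {f g : Arrow (ChainComplex (ModuleCat.{u} R) ℤ)} (φ : f ⟶ g) :
    ∀ b, side f b ⟶ side g b
  | true => φ.left
  | false => φ.right

/-- An arrow of chain complexes with chosen (non-linear) fillers: if `x` is a cycle
and `f x = d y`, then `lift x y` bounds `x` and `htpy x y` bounds
`f (lift x y) - y`. -/
structure FilledArrow (R : Type u) [CommRing R] where
  arrow : Arrow (ChainComplex (ModuleCat.{u} R) ℤ)
  lift {i : ℤ} (j : ℤ) : arrow.left.X i → arrow.right.X j → arrow.left.X j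
  htpy {i j : ℤ} (k : ℤ) : arrow.left.X i → arrow.right.X j → arrow.right.X k
  d_lift {i j : ℤ} (hij : i + 1 = j) (x : arrow.left.X i) (y : arrow.right.X j) :
    (∀ l, arrow.left.d i l x = 0) → arrow.hom.f i x = arrow.right.d j i y →
      arrow.left.d j i (lift j x y) = x
  d_htpy {i j k : ℤ} (hij : i + 1 = j) (hjk : j + 1 = k)
    (x : arrow.left.X i) (y : arrow.right.X j) :
    (∀ l, arrow.left.d i l x = 0) → arrow.hom.f i x = arrow.right.d j i y →
      arrow.right.d k j (htpy k x y) + y = arrow.hom.f j (lift j x y)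

namespace FilledArrow

/-- Morphisms of arrows that preserve the chosen fillers. -/
@[ext]
structure Hom (F G : FilledArrow R) where
  hom : F.arrow ⟶ G.arrow
  map_lift {i : ℤ} (j : ℤ) (x : F.arrow.left.X i) (y : F.arrow.right.X j) :
    hom.left.f j (F.lift j x y) = G.lift j (hom.left.f i x) (hom.right.f j y)
  map_htpy {i j : ℤ} (k : ℤ) (x : F.arrow.left.X i) (y : F.arrow.right.X j) :
    hom.right.f k (F.htpy k x y) = G.htpy k (hom.left.f i x) (hom.right.f j y)

instance : Category (FilledArrow R) where
  Hom := Hom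
  id F := ⟨𝟙 _, by simp, by simp⟩
  comp φ ψ := ⟨φ.hom ≫ ψ.hom, by simp [φ.map_lift, ψ.map_lift], by simp [φ.map_htpy, ψ.map_htpy]⟩

/-- The functor that forgets the chosen fillers. -/
def forget (R : Type u) [CommRing R] :
    FilledArrow R ⥤ Arrow (ChainComplex (ModuleCat.{u} R) ℤ) where
  obj F := F.arrow
  map φ := φ.hom

end FilledArrow

variable {f : Arrow (ChainComplex (ModuleCat.{u} R) ℤ)}

/-- Formal expressions for the elements of the free filled arrow on `f`. -/
inductive Term (f : Arrow (ChainComplex (ModuleCat.{u} R) ℤ)) : Bool → ℤ → Type u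
  | of {b : Bool} {i : ℤ} (x : (side f b).X i) : Term f b i
  | zero {b : Bool} {i : ℤ} : Term f b i
  | add {b : Bool} {i : ℤ} (s t : Term f b i) : Term f b i
  | smul {b : Bool} {i : ℤ} (r : R) (t : Term f b i) : Term f b i
  | d {b : Bool} {i : ℤ} (j : ℤ) (t : Term f b i) : Term f b j
  | map {i : ℤ} (t : Term f true i) : Term f false i
  | lift {i : ℤ} (j : ℤ) (s : Term f true i) (t : Term f false j) : Term f true j
  | htpy {i j : ℤ} (k : ℤ) (s : Term f true i) (t : Term f false j) : Term f false k

/-- The value of a formal expression in a filled arrow under `f`. -/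
def Term.eval (F : FilledArrow R) (φ : f ⟶ F.arrow) :
    ∀ {b : Bool} {i : ℤ}, Term f b i → (side F.arrow b).X i
  | b, i, of x => (sideMap φ b).f i x
  | _, _, zero => 0
  | _, _, add s t => s.eval F φ + t.eval F φ
  | _, _, smul r t => r • t.eval F φ
  | b, _, d (i := i) j t => (side F.arrow b).d i j (t.eval F φ)
  | _, _, map (i := i) t => F.arrow.hom.f i (t.eval F φ)
  | _, _, lift j s t => F.lift j (s.eval F φ) (t.eval F φ)
  | _, _, htpy k s t => F.htpy k (s.eval F φ) (t.eval F φ)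

/-- Expressions are identified when they agree in every filled arrow under `f`. -/
instance termSetoid (f : Arrow (ChainComplex (ModuleCat.{u} R) ℤ)) (b : Bool) (i : ℤ) :
    Setoid (Term f b i) where
  r s t := ∀ (F : FilledArrow R) (φ : f ⟶ F.arrow), s.eval F φ = t.eval F φ
  iseqv := ⟨fun _ _ _ ↦ rfl, fun h F φ ↦ (h F φ).symm, fun h h' F φ ↦ (h F φ).trans (h' F φ)⟩

/-- The degree `i` part of the source or target of the free filled arrow on `f`. -/
def FreeModule (f : Arrow (ChainComplex (ModuleCat.{u} R) ℤ)) (b : Bool) (i : ℤ) : Type u :=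
  Quotient (termSetoid f b i)

namespace FreeModule

variable {b : Bool} {i : ℤ}

/-- The class of a formal expression. -/
def mk (t : Term f b i) : FreeModule f b i := Quotient.mk _ t

theorem mk_surjective : Function.Surjective (mk : Term f b i → FreeModule f b i) :=
  Quotient.mk_surjective

theorem mk_eq_mk {s t : Term f b i} :
    mk s = mk t ↔ ∀ (F : FilledArrow R) (φ : f ⟶ F.arrow), s.eval F φ = t.eval F φ :=
  Quotient.eq

instance : Zero (FreeModule f b i) := ⟨mk .zero⟩
instance : Add (FreeModule f b i) :=
  ⟨Quotient.map₂ .add fun _ _ h _ _ h' F φ ↦ congrArg₂ (· + ·) (h F φ) (h' F φ)⟩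
instance : SMul R (FreeModule f b i) :=
  ⟨fun r ↦ Quotient.map (.smul r) fun _ _ h F φ ↦ congrArg (r • ·) (h F φ)⟩
instance : Neg (FreeModule f b i) := ⟨fun x ↦ (-1 : R) • x⟩

theorem zero_def : (0 : FreeModule f b i) = mk .zero := rfl
theorem mk_add_mk (s t : Term f b i) : mk s + mk t = mk (.add s t) := rfl
theorem smul_mk (r : R) (t : Term f b i) : r • mk t = mk (.smul r t) := rfl
theorem neg_mk (t : Term f b i) : -mk t = mk (.smul (-1) t) := rfl

instance : AddCommGroup (FreeModule f b i) where
  nsmul := nsmulRec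
  zsmul := zsmulRec
  add_assoc x y z := by
    obtain ⟨x, rfl⟩ := mk_surjective x
    obtain ⟨y, rfl⟩ := mk_surjective y
    obtain ⟨z, rfl⟩ := mk_surjective z
    simp [mk_add_mk, mk_eq_mk, Term.eval, add_assoc]
  zero_add x := by
    obtain ⟨x, rfl⟩ := mk_surjective x
    simp [zero_def, mk_add_mk, mk_eq_mk, Term.eval]
  add_zero x := by
    obtain ⟨x, rfl⟩ := mk_surjective x
    simp [zero_def, mk_add_mk, mk_eq_mk, Term.eval]
  neg_add_cancel x := by
    obtain ⟨x, rfl⟩ := mk_surjective x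
    simp [zero_def, neg_mk, mk_add_mk, mk_eq_mk, Term.eval]
  add_comm x y := by
    obtain ⟨x, rfl⟩ := mk_surjective x
    obtain ⟨y, rfl⟩ := mk_surjective y
    simp [mk_add_mk, mk_eq_mk, Term.eval, add_comm]

instance : Module R (FreeModule f b i) where
  one_smul x := by
    obtain ⟨x, rfl⟩ := mk_surjective x
    simp [smul_mk, mk_eq_mk, Term.eval]
  mul_smul r s x := by
    obtain ⟨x, rfl⟩ := mk_surjective x
    simp [smul_mk, mk_eq_mk, Term.eval, mul_smul]
  smul_zero r := by
    simp [zero_def, smul_mk, mk_eq_mk, Term.eval]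
  smul_add r x y := by
    obtain ⟨x, rfl⟩ := mk_surjective x
    obtain ⟨y, rfl⟩ := mk_surjective y
    simp [mk_add_mk, smul_mk, mk_eq_mk, Term.eval]
  add_smul r s x := by
    obtain ⟨x, rfl⟩ := mk_surjective x
    simp [mk_add_mk, smul_mk, mk_eq_mk, Term.eval, add_smul]
  zero_smul x := by
    obtain ⟨x, rfl⟩ := mk_surjective x
    simp [zero_def, smul_mk, mk_eq_mk, Term.eval]

/-- The differential of the free filled arrow. -/
def d (i j : ℤ) : FreeModule f b i →ₗ[R] FreeModule f b j where
  toFun := Quotient.map (.d j) fun _ _ h F φ ↦ congrArg ((side F.arrow b).d i j) (h F φ)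
  map_add' x y := by
    obtain ⟨x, rfl⟩ := mk_surjective x
    obtain ⟨y, rfl⟩ := mk_surjective y
    exact mk_eq_mk.2 fun F φ ↦ by simp [Term.eval]
  map_smul' r x := by
    obtain ⟨x, rfl⟩ := mk_surjective x
    exact mk_eq_mk.2 fun F φ ↦ by simp [Term.eval]

/-- The chain map underlying the free filled arrow, in degree `i`. -/
def map (i : ℤ) : FreeModule f true i →ₗ[R] FreeModule f false i where
  toFun := Quotient.map .map fun _ _ h F φ ↦ congrArg (F.arrow.hom.f i) (h F φ)
  map_add' x y := by
    obtain ⟨x, rfl⟩ := mk_surjective x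
    obtain ⟨y, rfl⟩ := mk_surjective y
    exact mk_eq_mk.2 fun F φ ↦ by simp [Term.eval]
  map_smul' r x := by
    obtain ⟨x, rfl⟩ := mk_surjective x
    exact mk_eq_mk.2 fun F φ ↦ by simp [Term.eval]

/-- The inclusion of the generators. -/
def of (f : Arrow (ChainComplex (ModuleCat.{u} R) ℤ)) (b : Bool) (i : ℤ) :
    (side f b).X i →ₗ[R] FreeModule f b i where
  toFun x := mk (.of x)
  map_add' x y := mk_eq_mk.2 fun F φ ↦ by simp [Term.eval]
  map_smul' r x := mk_eq_mk.2 fun F φ ↦ by simp [Term.eval]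

/-- Evaluation in a filled arrow under `f`. -/
def eval (F : FilledArrow R) (φ : f ⟶ F.arrow) (b : Bool) (i : ℤ) :
    FreeModule f b i →ₗ[R] (side F.arrow b).X i where
  toFun := Quotient.lift (Term.eval F φ) fun _ _ h ↦ h F φ
  map_add' x y := by
    obtain ⟨x, rfl⟩ := mk_surjective x
    obtain ⟨y, rfl⟩ := mk_surjective y
    rfl
  map_smul' r x := by
    obtain ⟨x, rfl⟩ := mk_surjective x
    rfl

end FreeModule

/-- The source or target of the free filled arrow on `f`. -/
def freeComplex (f : Arrow (ChainComplex (ModuleCat.{u} R) ℤ)) (b : Bool) :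
    ChainComplex (ModuleCat.{u} R) ℤ where
  X i := ModuleCat.of R (FreeModule f b i)
  d i j := ModuleCat.ofHom (FreeModule.d i j)
  shape i j hij := by
    ext x
    obtain ⟨x, rfl⟩ := FreeModule.mk_surjective x
    exact FreeModule.mk_eq_mk.2 fun F φ ↦ by simp [Term.eval, (side F.arrow b).shape _ _ hij]
  d_comp_d' i j k _ _ := by
    ext x
    obtain ⟨x, rfl⟩ := FreeModule.mk_surjective x
    exact FreeModule.mk_eq_mk.2 fun F φ ↦ by
      simp [Term.eval, ← ConcreteCategory.comp_apply]

/-- The free filled arrow on `f`. -/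
def free (f : Arrow (ChainComplex (ModuleCat.{u} R) ℤ)) : FilledArrow R where
  arrow := Arrow.mk (X := freeComplex f true) (Y := freeComplex f false)
    { f i := ModuleCat.ofHom (FreeModule.map i)
      comm' i j _ := by
        ext x
        obtain ⟨x, rfl⟩ := FreeModule.mk_surjective x
        exact FreeModule.mk_eq_mk.2 fun F φ ↦
          ConcreteCategory.congr_hom (F.arrow.hom.comm i j) _ }
  lift j := Quotient.map₂ (.lift j) fun _ _ h _ _ h' F φ ↦
    congrArg₂ (F.lift j) (h F φ) (h' F φ)
  htpy k := Quotient.map₂ (.htpy k) fun _ _ h _ _ h' F φ ↦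
    congrArg₂ (F.htpy k) (h F φ) (h' F φ)
  d_lift hij x y hx hxy := by
    obtain ⟨x, rfl⟩ := FreeModule.mk_surjective x
    obtain ⟨y, rfl⟩ := FreeModule.mk_surjective y
    exact FreeModule.mk_eq_mk.2 fun F φ ↦ F.d_lift hij _ _
      (fun l ↦ FreeModule.mk_eq_mk.1 (hx l) F φ) (FreeModule.mk_eq_mk.1 hxy F φ)
  d_htpy hij hjk x y hx hxy := by
    obtain ⟨x, rfl⟩ := FreeModule.mk_surjective x
    obtain ⟨y, rfl⟩ := FreeModule.mk_surjective y
    exact FreeModule.mk_eq_mk.2 fun F φ ↦ F.d_htpy hij hjk _ _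
      (fun l ↦ FreeModule.mk_eq_mk.1 (hx l) F φ) (FreeModule.mk_eq_mk.1 hxy F φ)

theorem sideMap_comm {f g : Arrow (ChainComplex (ModuleCat.{u} R) ℤ)} (φ : f ⟶ g) (i : ℤ)
    (x : f.left.X i) : g.hom.f i (φ.left.f i x) = φ.right.f i (f.hom.f i x) :=
  ConcreteCategory.congr_hom (HomologicalComplex.congr_hom (Arrow.w φ) i) x

/-- The inclusion of `f` into the free filled arrow on `f`, at the source or at the target. -/
def unitSide (f : Arrow (ChainComplex (ModuleCat.{u} R) ℤ)) (b : Bool) :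
    side f b ⟶ freeComplex f b where
  f i := ModuleCat.ofHom (FreeModule.of f b i)
  comm' i j _ := by
    ext x
    exact FreeModule.mk_eq_mk.2 fun F φ ↦
      ConcreteCategory.congr_hom ((sideMap φ b).comm i j) x

/-- The inclusion of `f` into the free filled arrow on `f`. -/
def unit (f : Arrow (ChainComplex (ModuleCat.{u} R) ℤ)) : f ⟶ (free f).arrow :=
  Arrow.homMk (unitSide f true) (unitSide f false) (by
    ext i x
    exact FreeModule.mk_eq_mk.2 fun F φ ↦ sideMap_comm φ i x)

/-- Evaluation of the free filled arrow, at the source or at the target. -/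
def evalSide (F : FilledArrow R) (φ : f ⟶ F.arrow) (b : Bool) :
    freeComplex f b ⟶ side F.arrow b where
  f i := ModuleCat.ofHom (FreeModule.eval F φ b i)
  comm' i j _ := by
    ext x
    obtain ⟨x, rfl⟩ := FreeModule.mk_surjective x
    rfl

/-- The morphism from the free filled arrow induced by a morphism of arrows. -/
def eval (F : FilledArrow R) (φ : f ⟶ F.arrow) : free f ⟶ F where
  hom := Arrow.homMk (evalSide F φ true) (evalSide F φ false) (by
    ext i x
    obtain ⟨x, rfl⟩ := FreeModule.mk_surjective x
    rfl)
  map_lift j x y := by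
    obtain ⟨x, rfl⟩ := FreeModule.mk_surjective x
    obtain ⟨y, rfl⟩ := FreeModule.mk_surjective y
    rfl
  map_htpy k x y := by
    obtain ⟨x, rfl⟩ := FreeModule.mk_surjective x
    obtain ⟨y, rfl⟩ := FreeModule.mk_surjective y
    rfl

theorem unit_eval (F : FilledArrow R) (φ : f ⟶ F.arrow) : unit f ≫ (eval F φ).hom = φ := by
  ext i x <;> rfl

/-- The class of a formal expression in the free filled arrow. -/
def freeMk : ∀ {b : Bool} {i : ℤ}, Term f b i → (side (free f).arrow b).X i
  | true, _, t => FreeModule.mk t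
  | false, _, t => FreeModule.mk t

theorem sideMap_freeMk (F : FilledArrow R) (ψ : free f ⟶ F) {b : Bool} {i : ℤ} (t : Term f b i) :
    (sideMap ψ.hom b).f i (freeMk t) = t.eval F (unit f ≫ ψ.hom) := by
  induction t with
  | @of b i x => cases b <;> rfl
  | @zero b i => cases b <;> exact map_zero ((sideMap ψ.hom _).f i).hom
  | @add b i s t hs ht =>
    cases b <;>
      exact (map_add ((sideMap ψ.hom _).f i).hom (freeMk s) (freeMk t)).trans
        (congrArg₂ (· + ·) hs ht)
  | @smul b i r t ht =>
    cases b <;>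
      exact (map_smul ((sideMap ψ.hom _).f i).hom r (freeMk t)).trans (congrArg (r • ·) ht)
  | @d b i j t ht =>
    have h := ConcreteCategory.congr_hom ((sideMap ψ.hom b).comm i j) (freeMk t)
    cases b <;> exact h.symm.trans (congrArg ((side F.arrow _).d i j) ht)
  | @map i t ht =>
    exact (sideMap_comm ψ.hom i (freeMk t)).symm.trans (congrArg (F.arrow.hom.f i) ht)
  | @lift i j s t hs ht =>
    exact (ψ.map_lift j (freeMk s) (freeMk t)).trans (congrArg₂ (F.lift j) hs ht)
  | @htpy i j k s t hs ht =>
    exact (ψ.map_htpy k (freeMk s) (freeMk t)).trans (congrArg₂ (F.htpy k) hs ht)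

theorem eval_unit (F : FilledArrow R) (ψ : free f ⟶ F) : eval F (unit f ≫ ψ.hom) = ψ := by
  refine FilledArrow.Hom.ext (Arrow.hom_ext _ _ ?_ ?_)
  all_goals
    ext i x
    obtain ⟨x, rfl⟩ := FreeModule.mk_surjective x
    exact (sideMap_freeMk F ψ x).symm

/-- The free filled arrow is left adjoint to forgetting the fillers. -/
def adjunction (R : Type u) [CommRing R] :
    Adjunction.leftAdjointOfEquiv (F_obj := free) (G := FilledArrow.forget R)
      (fun f F ↦ ⟨fun ψ ↦ unit f ≫ ψ.hom, eval F, eval_unit F, unit_eval F⟩)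
      (fun _ _ _ _ _ ↦ rfl) ⊣ FilledArrow.forget R :=
  Adjunction.adjunctionOfEquivLeft _ _

section Homology

variable {K L : ChainComplex (ModuleCat.{u} R) ℤ} (φ : K ⟶ L)

theorem mono_homologyMap_iff {i j k : ℤ} (hij : i + 1 = j) (hjk : j + 1 = k) :
    Mono (HomologicalComplex.homologyMap φ j) ↔
      ∀ (x : K.X j) (y : L.X k), K.d j i x = 0 → φ.f j x = L.d k j y →
        ∃ x', K.d k j x' = x := by
  rw [HomologicalComplex.mono_homologyMap_iff_up_to_refinements φ k j i
    ((ComplexShape.down ℤ).prev_eq' hjk) ((ComplexShape.down ℤ).next_eq' hij)]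
  constructor
  · intro h x y hx hxy
    obtain ⟨A, π, hπ, x', hx'⟩ := h
      (ModuleCat.ofHom (LinearMap.toSpanSingleton R (K.X j) x)) (by ext; simpa using hx)
      (ModuleCat.ofHom (LinearMap.toSpanSingleton R (L.X k) y)) (by ext; simpa using hxy)
    obtain ⟨a, ha⟩ := (ModuleCat.epi_iff_surjective π).1 hπ (1 : R)
    refine ⟨x' a, ?_⟩
    simpa [ha] using (ConcreteCategory.congr_hom hx' a).symm
  · intro h A x hx y hxy
    choose x' hx' using fun a : A ↦ h (x a) (y a) (ConcreteCategory.congr_hom hx a)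
      (ConcreteCategory.congr_hom hxy a)
    refine ⟨ModuleCat.of R (A →₀ R), ModuleCat.ofHom (Finsupp.linearCombination R id),
      (ModuleCat.epi_iff_surjective _).2 (Finsupp.linearCombination_id_surjective R A),
      ModuleCat.ofHom (Finsupp.linearCombination R x'), ?_⟩
    ext a
    simp [hx']

theorem epi_homologyMap_iff {i j k : ℤ} (hij : i + 1 = j) (hjk : j + 1 = k) :
    Epi (HomologicalComplex.homologyMap φ j) ↔
      ∀ y : L.X j, L.d j i y = 0 →
        ∃ x, K.d j i x = 0 ∧ ∃ y', y = φ.f j x + L.d k j y' := by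
  rw [HomologicalComplex.epi_homologyMap_iff_up_to_refinements φ k j i
    ((ComplexShape.down ℤ).prev_eq' hjk) ((ComplexShape.down ℤ).next_eq' hij)]
  constructor
  · intro h y hy
    obtain ⟨A, π, hπ, x, hx, y', hy'⟩ := h
      (ModuleCat.ofHom (LinearMap.toSpanSingleton R (L.X j) y)) (by ext; simpa using hy)
    obtain ⟨a, ha⟩ := (ModuleCat.epi_iff_surjective π).1 hπ (1 : R)
    refine ⟨x a, ConcreteCategory.congr_hom hx a, y' a, ?_⟩
    simpa [ha] using ConcreteCategory.congr_hom hy' a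
  · intro h A y hy
    choose x hx y' hy' using fun a : A ↦ h (y a) (ConcreteCategory.congr_hom hy a)
    refine ⟨ModuleCat.of R (A →₀ R), ModuleCat.ofHom (Finsupp.linearCombination R id),
      (ModuleCat.epi_iff_surjective _).2 (Finsupp.linearCombination_id_surjective R A),
      ModuleCat.ofHom (Finsupp.linearCombination R x), ?_,
      ModuleCat.ofHom (Finsupp.linearCombination R y'), ?_⟩
    · ext a
      simp [hx]
    · ext a
      simp [← hy']

/-- A chain map is a quasi-isomorphism if and only if the cycles of its mapping cone are
boundaries. -/
theorem quasiIso_iff_exists_filler :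
    QuasiIso φ ↔ ∀ (i j k : ℤ), i + 1 = j → j + 1 = k → ∀ (x : K.X i) (y : L.X j),
      (∀ l, K.d i l x = 0) → φ.f i x = L.d j i y →
        ∃ x' y', K.d j i x' = x ∧ L.d k j y' + y = φ.f j x' := by
  have h_iff : QuasiIso φ ↔ ∀ j, Mono (HomologicalComplex.homologyMap φ j) ∧
      Epi (HomologicalComplex.homologyMap φ j) := by
    simp_rw [quasiIso_iff, quasiIsoAt_iff_isIso_homologyMap, isIso_iff_mono_and_epi]
  rw [h_iff]
  constructor
  · intro h i j k hij hjk x y hx hxy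
    obtain ⟨x₁, rfl⟩ := (mono_homologyMap_iff φ (sub_add_cancel i 1) hij).1 (h i).1 x y
      (hx _) hxy
    have hcomm : L.d j i (φ.f j x₁) = φ.f i (K.d j i x₁) :=
      ConcreteCategory.congr_hom (φ.comm j i) x₁
    obtain ⟨x₂, hx₂, y₂, hy₂⟩ := (epi_homologyMap_iff φ hij hjk).1 (h j).2 (φ.f j x₁ - y)
      (by rw [map_sub, hcomm, hxy, sub_self])
    refine ⟨x₁ - x₂, y₂, by rw [map_sub, hx₂, sub_zero], ?_⟩
    rw [map_sub, sub_eq_iff_eq_add.1 hy₂]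
    abel
  · intro h j
    have hd {M : ChainComplex (ModuleCat.{u} R) ℤ} (i : ℤ) (hij : i + 1 = j) (x : M.X j)
        (hx : M.d j i x = 0) (l : ℤ) : M.d j l x = 0 := by
      by_cases hl : l + 1 = j
      · obtain rfl : l = i := by lia
        exact hx
      · rw [M.shape _ _ hl]
        rfl
    constructor
    · refine (mono_homologyMap_iff φ (sub_add_cancel j 1) rfl).2 fun x y hx hxy ↦ ?_
      obtain ⟨x', -, hx', -⟩ := h j _ _ rfl rfl x y (hd _ (sub_add_cancel j 1) x hx) hxy
      exact ⟨x', hx'⟩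
    · refine (epi_homologyMap_iff φ (sub_add_cancel j 1) rfl).2 fun y hy ↦ ?_
      obtain ⟨x', y', hx', hy'⟩ := h _ j _ (sub_add_cancel j 1) rfl 0 y (by simp)
        (by rw [hy, map_zero])
      refine ⟨x', hx', -y', ?_⟩
      rw [map_neg, ← hy']
      abel

end Homology

theorem FilledArrow.quasiIso (F : FilledArrow R) : QuasiIso F.arrow.hom :=
  (quasiIso_iff_exists_filler _).2 fun _ _ _ hij hjk x y hx hxy ↦
    ⟨F.lift _ x y, F.htpy _ x y, F.d_lift hij x y hx hxy, F.d_htpy hij hjk x y hx hxy⟩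

open Classical in
/-- A quasi-isomorphism admits fillers. -/
theorem FilledArrow.exists_arrow_eq (hf : QuasiIso f.hom) : ∃ F : FilledArrow R, F.arrow = f := by
  have h := (quasiIso_iff_exists_filler f.hom).1 hf
  choose lift htpy d_lift d_htpy using h
  exact ⟨{
    arrow := f
    lift {i} j x y :=
      if hxy : i + 1 = j ∧ (∀ l, f.left.d i l x = 0) ∧ f.hom.f i x = f.right.d j i y then
        lift i j (j + 1) hxy.1 rfl x y hxy.2.1 hxy.2.2
      else 0
    htpy {i j} k x y :=
      if hxy : (i + 1 = j ∧ j + 1 = k) ∧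
          (∀ l, f.left.d i l x = 0) ∧ f.hom.f i x = f.right.d j i y then
        htpy i j k hxy.1.1 hxy.1.2 x y hxy.2.1 hxy.2.2
      else 0
    d_lift {i j} hij x y hx hxy := by
      rw [dif_pos ⟨hij, hx, hxy⟩]
      apply d_lift
    d_htpy {i j k} hij hjk x y hx hxy := by
      subst hjk
      rw [dif_pos ⟨⟨hij, rfl⟩, hx, hxy⟩, dif_pos ⟨hij, hx, hxy⟩]
      apply d_htpy }, rfl⟩

end QuasiIsoMonad

open QuasiIsoMonad

/-- There is a monad on the arrow category of unbounded chain complexes of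
`R`-modules such that an object (a chain map) admits a `T`-algebra structure if and only if it is
a quasi-isomorphism. -/
theorem exists_monad_detecting_quasiIso (R : Type u) [CommRing R] :
    ∃ T : Monad (Arrow (ChainComplex (ModuleCat.{u} R) ℤ)),
      ∀ f : Arrow (ChainComplex (ModuleCat.{u} R) ℤ),
        (∃ a : T.obj f ⟶ f,
          T.η.app f ≫ a = 𝟙 f ∧ T.μ.app f ≫ a = T.map a ≫ a) ↔ QuasiIso f.hom := by
  refine ⟨(adjunction R).toMonad, fun f ↦ ⟨fun ⟨a, ha, _⟩ ↦ ?_, fun hf ↦ ?_⟩⟩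
  · have r : RetractArrow f.hom (free f).arrow.hom :=
      { i := (adjunction R).toMonad.η.app f
        r := a
        retract := ha }
    exact (HomologicalComplex.quasiIso _ _).of_retract r (free f).quasiIso
  · obtain ⟨F, rfl⟩ := FilledArrow.exists_arrow_eq hf
    let A := (Monad.comparison (adjunction R)).obj F
    exact ⟨A.a, A.unit, A.assoc⟩
end

section
/- Let C be a locally presentable category. There exists a monad T on the arrow category Arr(C) such that an object f : A ⟶ B of Arr(C) admits a T-algebra structure if and only if f is a pure monomorphism. -/
open CategoryTheory Limits

universe v u

/-- A morphism `f : A ⟶ B` is a pure monomorphism if every commutative square `r ≫ f = j ≫ s`,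
where `j : n ⟶ m` is a morphism between finitely presentable (`ℵ₀`-presentable) objects, admits
a diagonal `d : m ⟶ A` with `j ≫ d = r`. -/
def IsPureMono {C : Type u} [Category.{v} C] {A B : C} (f : A ⟶ B) : Prop :=
  ∀ n m : C, IsCardinalPresentableObj Cardinal.aleph0 n →
    IsCardinalPresentableObj Cardinal.aleph0 m →
    ∀ (j : n ⟶ m) (r : n ⟶ A) (s : m ⟶ B), r ≫ f = j ≫ s → ∃ d : m ⟶ A, j ≫ d = r

section Translation

attribute [local instance] Cardinal.fact_isRegular_aleph0

lemma IsCardinalFilteredCat.of_isCardinalFiltered {κ : Cardinal.{v}} [Fact κ.IsRegular]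
    (J : Type v) [SmallCategory J] [IsCardinalFiltered J κ] :
    IsCardinalFilteredCat κ (Cat.of J) :=
  fun A hA (F : A ⥤ J) ↦ IsCardinalFiltered.nonempty_cocone (κ := κ) F
    ((hasCardinalLT_iff_cardinal_mk_lt _ _).2 hA)

lemma IsCardinalFilteredCat.isCardinalFiltered {κ : Cardinal.{v}} [Fact κ.IsRegular]
    {J : Cat.{v, v}} (hJ : IsCardinalFilteredCat κ J) : IsCardinalFiltered J κ where
  nonempty_cocone {A} _ F hA := hJ (Cat.of A) ((hasCardinalLT_iff_cardinal_mk_lt _ _).1 hA) F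

variable {C : Type u} [Category.{v} C]

lemma IsCardinalPresentableObj.isCardinalPresentable {κ : Cardinal.{v}} [Fact κ.IsRegular]
    {X : C} (hX : IsCardinalPresentableObj κ X) : IsCardinalPresentable X κ where
  preservesColimitOfShape J _ _ := (hX (Cat.of J) (.of_isCardinalFiltered J)).some

lemma IsLocallyPresentableCat.exists_isCardinalLocallyPresentable
    (hC : IsLocallyPresentableCat C) :
    ∃ (κ : Cardinal.{v}) (_ : Fact κ.IsRegular), IsCardinalLocallyPresentable C κ := by
  obtain ⟨⟨κ, hκ, -, S, hS, hSκ, hS'⟩, _⟩ := hC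
  have : Fact κ.IsRegular := ⟨hκ⟩
  let P : ObjectProperty C := fun X ↦ X ∈ S
  have : ObjectProperty.Small.{v} P := hS
  have hP : P.IsCardinalFilteredGenerator κ :=
    { le_isCardinalPresentable := fun X hX ↦ (hSκ X hX).isCardinalPresentable
      exists_colimitsOfShape := fun X ↦ by
        obtain ⟨J, hJ, F, hF, c, ⟨hc⟩, ⟨e⟩⟩ := hS' X
        exact ⟨J, inferInstance, hJ.isCardinalFiltered,
          ⟨ObjectProperty.ColimitOfShape.ofIso
            { diag := F, ι := c.ι, isColimit := hc, prop_diag_obj := hF } e⟩⟩ }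
  have := hP.hasCardinalFilteredGenerator
  exact ⟨κ, inferInstance, { }⟩

/-- The property of objects that are finitely presentable. -/
def isFinitelyPresentableObj (C : Type u) [Category.{v} C] : ObjectProperty C :=
  IsCardinalPresentableObj Cardinal.aleph0

lemma IsLocallyPresentableCat.essentiallySmall_isFinitelyPresentableObj
    (hC : IsLocallyPresentableCat C) :
    ObjectProperty.EssentiallySmall.{v} (isFinitelyPresentableObj C) := by
  obtain ⟨κ, _, _⟩ := hC.exists_isCardinalLocallyPresentable
  refine ObjectProperty.EssentiallySmall.of_le (Q := isCardinalPresentable C κ) fun X hX ↦ ?_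
  have : IsCardinalPresentable X Cardinal.aleph0 := hX.isCardinalPresentable
  exact isCardinalPresentable_of_le X (Cardinal.IsRegular.aleph0_le Fact.out)

lemma CategoryTheory.IsCardinalLocallyPresentable.hasLimits (C : Type u) [Category.{v} C]
    (κ : Cardinal.{v}) [Fact κ.IsRegular] [IsCardinalLocallyPresentable C κ] : HasLimits C := by
  let P := isCardinalPresentable C κ
  let A : SmallModel.{v} P.FullSubcategory ⥤ C := (equivSmallModel.{v} _).inverse ⋙ P.ι
  have : HasColimitsOfSize.{v, v} C := IsCardinalLocallyPresentable.toHasColimitsOfSize κ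
  let L := (uliftYoneda.{v}).leftKanExtension A
  let adj := Presheaf.uliftYonedaAdjunction.{v} L (uliftYoneda.leftKanExtensionUnit A)
  let : Reflective (Presheaf.restrictedULiftYoneda.{v} A) := { L := L, adj := adj }
  exact hasLimits_of_reflective (Presheaf.restrictedULiftYoneda.{v} A)

end Translation

namespace CategoryTheory

variable {E : Type u} [Category.{v} E]

/-- An object `X` is sequentially small if any morphism from `X` to a sequential colimit factors
through one of the objects of the sequence. -/
def IsSequentiallySmall (X : E) : Prop :=
  ∀ (F : ℕ ⥤ E) (c : Cocone F), IsColimit c → ∀ r : X ⟶ c.pt,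
    ∃ (n : ℕ) (p : X ⟶ F.obj n), p ≫ c.ι.app n = r

variable {ι : Type v} {s t : ι → E} (k : ∀ i, s i ⟶ t i)

/-- An algebraically injective object relative to a family of morphisms `k`: an object equipped
with a choice of extensions along all the morphisms of the family. -/
structure AlgInjective where
  /-- the underlying object -/
  obj : E
  /-- the chosen extensions -/
  ext (i : ι) (r : s i ⟶ obj) : t i ⟶ obj
  fac (i : ι) (r : s i ⟶ obj) : k i ≫ ext i r = r

namespace AlgInjective

variable {k}

/-- Morphisms of algebraically injective objects are the morphisms that preserve the chosen
extensions. -/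
@[ext]
structure Hom (X Y : AlgInjective k) where
  /-- the underlying morphism -/
  hom : X.obj ⟶ Y.obj
  comm (i : ι) (r : s i ⟶ X.obj) : X.ext i r ≫ hom = Y.ext i (r ≫ hom)

@[simps]
instance : Category (AlgInjective k) where
  Hom := Hom
  id X := { hom := 𝟙 _, comm := by simp }
  comp f g :=
    { hom := f.hom ≫ g.hom
      comm i r := by rw [← Category.assoc, Hom.comm, Hom.comm, Category.assoc] }

variable (k) in
/-- The functor which forgets the chosen extensions. -/
@[simps]
def forget : AlgInjective k ⥤ E where
  obj X := X.obj
  map f := f.hom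

@[ext]
lemma hom_ext {X Y : AlgInjective k} {f g : X ⟶ Y} (h : f.hom = g.hom) : f = g := Hom.ext h

section Limits

variable {J : Type*} [Category* J] (F : J ⥤ AlgInjective k) {c : Cone (F ⋙ forget k)}
  (hc : IsLimit c)

/-- The chosen extensions on a limit of algebraically injective objects. -/
def limitObj : AlgInjective k where
  obj := c.pt
  ext i r := hc.lift
    { pt := t i
      π :=
        { app j := (F.obj j).ext i (r ≫ c.π.app j)
          naturality j j' f := (Category.id_comp _).trans (((F.map f).comm i _).trans
            (congrArg ((F.obj j').ext i)
              ((Category.assoc _ _ _).trans (r ≫= c.w f)))).symm } }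
  fac i r := hc.hom_ext fun j ↦ by
    rw [Category.assoc, hc.fac]
    exact (F.obj j).fac _ _

/-- The limit cone of algebraically injective objects above a limit cone. -/
def limitCone : Cone F where
  pt := limitObj F hc
  π :=
    { app j := { hom := c.π.app j, comm := fun _ _ ↦ hc.fac _ _ }
      naturality _ _ f := hom_ext (c.π.naturality f) }

/-- The limit cone of algebraically injective objects is a limit. -/
def isLimitLimitCone : IsLimit (limitCone F hc) where
  lift d :=
    { hom := hc.lift ((forget k).mapCone d)
      comm i r := hc.hom_ext fun j ↦ by
        let l : d.pt.obj ⟶ c.pt := hc.lift ((forget k).mapCone d)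
        have h : (r ≫ l) ≫ c.π.app j = r ≫ (d.π.app j).hom :=
          (Category.assoc _ _ _).trans (r ≫= hc.fac ((forget k).mapCone d) j)
        have h' : (limitObj F hc).ext i (r ≫ l) ≫ c.π.app j =
            (F.obj j).ext i ((r ≫ l) ≫ c.π.app j) := hc.fac _ j
        exact (Category.assoc _ _ _).trans
          (((d.pt.ext i r ≫= hc.fac ((forget k).mapCone d) j).trans
            ((d.π.app j).comm i r)).trans
            (h'.trans (congrArg ((F.obj j).ext i) h)).symm) }
  fac d j := hom_ext (hc.fac ((forget k).mapCone d) j)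
  uniq d m hm := hom_ext (hc.uniq ((forget k).mapCone d) m.hom fun j ↦
    congrArg AlgInjective.Hom.hom (hm j))

instance [HasLimitsOfShape J E] : HasLimitsOfShape J (AlgInjective k) where
  has_limit F := ⟨⟨limitCone F (limit.isLimit _), isLimitLimitCone F (limit.isLimit _)⟩⟩

instance [HasLimitsOfShape J E] : PreservesLimitsOfShape J (forget k) where
  preservesLimit {F} := preservesLimit_of_preserves_limit_cone
    (isLimitLimitCone F (limit.isLimit (F ⋙ forget k))) (limit.isLimit (F ⋙ forget k))

end Limits

variable (k) in
lemma exists_universal_step [HasColimitsOfSize.{v, v} E] (X : E) :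
    ∃ (X' : E) (x : X ⟶ X') (e : ∀ i, (s i ⟶ X) → (t i ⟶ X')),
      (∀ i r, k i ≫ e i r = r ≫ x) ∧
      ∀ (Y : E) (g : X ⟶ Y) (d : ∀ i, (s i ⟶ X) → (t i ⟶ Y)),
        (∀ i r, k i ≫ d i r = r ≫ g) → ∃ g' : X' ⟶ Y, x ≫ g' = g ∧ ∀ i r, e i r ≫ g' = d i r := by
  let S (a : Σ i, s i ⟶ X) : E := s a.1
  let T (a : Σ i, s i ⟶ X) : E := t a.1
  let K : ∐ S ⟶ ∐ T := Limits.Sigma.map fun a ↦ k a.1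
  let ρ : ∐ S ⟶ X := Limits.Sigma.desc fun a ↦ a.2
  have : HasPushouts E := inferInstance
  refine ⟨pushout K ρ, pushout.inr _ _,
    fun i r ↦ Limits.Sigma.ι T ⟨i, r⟩ ≫ pushout.inl _ _, fun i r ↦ ?_, fun Y g d h ↦ ?_⟩
  · have h := Limits.Sigma.ι S ⟨i, r⟩ ≫= pushout.condition (f := K) (g := ρ)
    simpa [K, ρ] using h
  · exact ⟨pushout.desc (Limits.Sigma.desc fun a ↦ d a.1 a.2) g
      (Limits.Sigma.hom_ext _ _ fun a ↦ by simp [K, ρ, h]), pushout.inr_desc _ _ _, fun i r ↦ by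
        rw [Category.assoc, pushout.inl_desc]
        exact Limits.Sigma.ι_desc _ _⟩

variable (k) in
/-- The small object argument with countably many steps yields a weakly initial algebraically
injective object under any given object. -/
lemma exists_weakly_initial [HasColimitsOfSize.{v, v} E]
    (hs : ∀ i, IsSequentiallySmall (s i)) (X : E) :
    ∃ (A : AlgInjective k) (f : X ⟶ A.obj),
      ∀ (Y : AlgInjective k) (h : X ⟶ Y.obj), ∃ g : A ⟶ Y, f ≫ g.hom = h := by
  have : HasColimitsOfSize.{0, 0} E := hasColimitsOfSizeShrink.{0, 0, v, v} E
  choose X' x e he hX' using exists_universal_step k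
  let Z (n : ℕ) : E := n.rec X fun _ ↦ X'
  let F : ℕ ⥤ E := Functor.ofSequence (X := Z) fun n ↦ x (Z n)
  let L : E := colimit F
  let inj (n : ℕ) : Z n ⟶ L := colimit.ι F n
  have h_inj (n : ℕ) : x (Z n) ≫ inj (n + 1) = inj n := by
    have h := colimit.w F (homOfLE (Nat.le_add_right n 1))
    rw [Functor.ofSequence_map_homOfLE_succ] at h
    exact h
  have h_exists (i : ι) (r : s i ⟶ L) : ∃ (n : ℕ) (p : s i ⟶ Z n), p ≫ inj n = r :=
    hs i F (colimit.cocone F) (colimit.isColimit F) r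
  choose n p hp using h_exists
  let A : AlgInjective k :=
    { obj := L
      ext i r := e (Z (n i r)) i (p i r) ≫ inj (n i r + 1)
      fac i r := by
        have h := he (Z (n i r)) i (p i r) =≫ inj (n i r + 1)
        rw [Category.assoc, Category.assoc, h_inj, hp] at h
        exact h }
  refine ⟨A, inj 0, fun Y h ↦ ?_⟩
  choose g' hg' hg'' using fun (W : E) (g : W ⟶ Y.obj) ↦
    hX' W Y.obj g (fun i r ↦ Y.ext i (r ≫ g)) fun i r ↦ Y.fac _ _
  let g (n : ℕ) : Z n ⟶ Y.obj := n.rec h fun n g ↦ g' (Z n) g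
  let c : Cocone F := ⟨Y.obj, NatTrans.ofSequence g fun n ↦ by
    rw [Functor.ofSequence_map_homOfLE_succ]
    exact (hg' (Z n) (g n)).trans (Category.comp_id _).symm⟩
  let l : L ⟶ Y.obj := colimit.desc F c
  have hl (n : ℕ) : inj n ≫ l = g n := colimit.ι_desc c n
  refine ⟨⟨l, fun i r ↦ ?_⟩, hl 0⟩
  have hr : r ≫ l = p i r ≫ g (n i r) := by
    rw [← hl, ← Category.assoc, hp]
  calc (e (Z (n i r)) i (p i r) ≫ inj (n i r + 1)) ≫ l
    _ = e (Z (n i r)) i (p i r) ≫ g (n i r + 1) := by rw [Category.assoc, hl]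
    _ = Y.ext i (p i r ≫ g (n i r)) := hg'' _ _ _ _
    _ = Y.ext i (r ≫ l) := by rw [hr]

lemma isRightAdjoint_forget [HasColimitsOfSize.{v, v} E] [HasLimits E]
    (hs : ∀ i, IsSequentiallySmall (s i)) :
    (forget k).IsRightAdjoint := by
  have : HasLimits (AlgInjective k) := ⟨fun _ _ ↦ inferInstance⟩
  have : PreservesLimits (forget k) := ⟨inferInstance⟩
  refine isRightAdjoint_of_preservesLimits_of_solutionSetCondition _ fun X ↦ ?_
  obtain ⟨A, f, hf⟩ := exists_weakly_initial k hs X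
  exact ⟨PUnit, fun _ ↦ A, fun _ ↦ f, fun Y h ↦ ⟨⟨⟩, hf Y h⟩⟩

end AlgInjective

/-- For a family of morphisms with small domains, the objects that are injective with respect to
the family are exactly those that admit an algebra structure for a suitable monad. -/
lemma exists_monad_detecting_injectives [HasColimitsOfSize.{v, v} E] [HasLimits E]
    (hs : ∀ i, IsSequentiallySmall (s i)) :
    ∃ T : Monad E, ∀ X : E,
      (∃ a : T.obj X ⟶ X, T.η.app X ≫ a = 𝟙 X ∧ T.μ.app X ≫ a = T.map a ≫ a) ↔
        ∀ (i : ι) (r : s i ⟶ X), ∃ d : t i ⟶ X, k i ≫ d = r := by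
  have := AlgInjective.isRightAdjoint_forget (k := k) hs
  let adj := Adjunction.ofIsRightAdjoint (AlgInjective.forget k)
  refine ⟨adj.toMonad, fun X ↦ ⟨?_, fun h ↦ ?_⟩⟩
  · rintro ⟨a, ha, -⟩ i r
    let A := (AlgInjective.forget k).leftAdjoint.obj X
    let u : X ⟶ A.obj := adj.unit.app X
    let b : A.obj ⟶ X := a
    have hb : u ≫ b = 𝟙 X := ha
    refine ⟨A.ext i (r ≫ u) ≫ b, ?_⟩
    rw [← Category.assoc, AlgInjective.fac, Category.assoc, hb, Category.comp_id]
  · choose d hd using h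
    let A : AlgInjective k := ⟨X, d, hd⟩
    exact ⟨(adj.counit.app A).hom, adj.right_triangle_components A,
      congrArg AlgInjective.Hom.hom (adj.counit.naturality (adj.counit.app A)).symm⟩

end CategoryTheory

section PureMono

variable {C : Type u} [Category.{v} C]

lemma IsCardinalPresentableObj.preservesColimitsOfShape_nat {X : C}
    (hX : IsCardinalPresentableObj Cardinal.aleph0 X) :
    PreservesColimitsOfShape ℕ (coyoneda.obj (.op X)) := by
  have : Fact Cardinal.aleph0.{v}.IsRegular := Cardinal.fact_isRegular_aleph0
  have := hX.isCardinalPresentable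
  have : IsCardinalFiltered ℕ Cardinal.aleph0.{v} :=
    (isCardinalFiltered_aleph0_iff ℕ).2 inferInstance
  exact preservesColimitsOfShape_of_isCardinalPresentable_of_essentiallySmall X
    Cardinal.aleph0.{v} ℕ

/-- For `j : n ⟶ m`, the morphism in the category of arrows from `j` to the second inclusion
`m ⟶ m ⨿ₙ m` such that an arrow is injective with respect to it if and only if it satisfies the
purity condition for `j`. -/
noncomputable def purityArrow [HasPushouts C] (j : Arrow C) :
    j ⟶ Arrow.mk (pushout.inr j.hom j.hom) :=
  Arrow.homMk j.hom (pushout.inl j.hom j.hom) pushout.condition.symm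

lemma exists_purityArrow_comp_eq_iff [HasPushouts C] {j f : Arrow C} (r : j ⟶ f) :
    (∃ d, purityArrow j ≫ d = r) ↔ ∃ d : j.right ⟶ f.left, j.hom ≫ d = r.left := by
  constructor
  · rintro ⟨d, rfl⟩
    exact ⟨d.left, rfl⟩
  · rintro ⟨d, hd⟩
    refine ⟨Arrow.homMk d (pushout.desc r.right (d ≫ f.hom) ?_) ?_, ?_⟩
    · rw [← Category.assoc, hd]
      exact r.w.symm
    · exact (pushout.inr_desc _ _ _).symm
    · ext
      · exact hd
      · exact pushout.inl_desc _ _ _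

lemma isSequentiallySmall_arrow [HasColimitsOfShape ℕ C] {j : Arrow C}
    (hn : IsCardinalPresentableObj Cardinal.aleph0 j.left)
    (hm : IsCardinalPresentableObj Cardinal.aleph0 j.right) :
    IsSequentiallySmall j := by
  intro F c hc r
  have := hn.preservesColimitsOfShape_nat
  have := hm.preservesColimitsOfShape_nat
  have hl := isColimitOfPreserves Arrow.leftFunc hc
  have hr := isColimitOfPreserves Arrow.rightFunc hc
  obtain ⟨a, p, hp⟩ : ∃ (a : ℕ) (p : j.left ⟶ (F.obj a).left), p ≫ (c.ι.app a).left = r.left :=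
    exists_hom_of_preservesColimit_coyoneda hl r.left
  obtain ⟨b, q, hq⟩ : ∃ (b : ℕ) (q : j.right ⟶ (F.obj b).right),
      q ≫ (c.ι.app b).right = r.right :=
    exists_hom_of_preservesColimit_coyoneda hr r.right
  have h_eq : (p ≫ (F.obj a).hom) ≫ (c.ι.app a).right = (j.hom ≫ q) ≫ (c.ι.app b).right := by
    have h₁ : (c.ι.app a).left ≫ c.pt.hom = (F.obj a).hom ≫ (c.ι.app a).right := (c.ι.app a).w
    have h₂ : r.left ≫ c.pt.hom = j.hom ≫ r.right := r.w
    rw [Category.assoc, Category.assoc, hq, ← h₁, ← Category.assoc, hp, h₂]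
  obtain ⟨m, f, g, h⟩ : ∃ (m : ℕ) (f : a ⟶ m) (g : b ⟶ m),
      (p ≫ (F.obj a).hom) ≫ (F.map f).right = (j.hom ≫ q) ≫ (F.map g).right :=
    exists_eq_of_preservesColimit_coyoneda hr _ _ h_eq
  refine ⟨m, Arrow.homMk (p ≫ (F.map f).left) (q ≫ (F.map g).right) ?_, ?_⟩
  · have h₁ : (F.map f).left ≫ (F.obj m).hom = (F.obj a).hom ≫ (F.map f).right := (F.map f).w
    rw [Category.assoc, h₁, ← Category.assoc, h, Category.assoc]
  · have h₁ : (F.map f).left ≫ (c.ι.app m).left = (c.ι.app a).left :=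
      congrArg CommaMorphism.left (c.w f)
    have h₂ : (F.map g).right ≫ (c.ι.app m).right = (c.ι.app b).right :=
      congrArg CommaMorphism.right (c.w g)
    refine Arrow.hom_ext _ _ ?_ ?_
    · exact (Category.assoc _ _ _).trans ((p ≫= h₁).trans hp)
    · exact (Category.assoc _ _ _).trans ((q ≫= h₂).trans hq)

end PureMono

/-- For a locally presentable category `C` there is a monad `T` on the arrow
category of `C` such that an object of `Arrow C` admits a `T`-algebra structure iff it is a pure
monomorphism. -/
theorem exists_monad_detecting_pure_monos
    {C : Type u} [Category.{v} C] (hC : IsLocallyPresentableCat C) :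
    ∃ T : Monad (Arrow C), ∀ f : Arrow C,
      (∃ a : T.obj f ⟶ f, T.η.app f ≫ a = 𝟙 f ∧ T.μ.app f ≫ a = T.map a ≫ a) ↔
        IsPureMono f.hom := by
  have := hC.2
  have : HasColimitsOfSize.{0, 0} C := hasColimitsOfSizeShrink.{0, 0, v, v} C
  obtain ⟨κ, _, _⟩ := hC.exists_isCardinalLocallyPresentable
  have := IsCardinalLocallyPresentable.hasLimits C κ
  have := hC.essentiallySmall_isFinitelyPresentableObj
  let P := isFinitelyPresentableObj C
  obtain ⟨Q, _, hQP, hPQ⟩ := ObjectProperty.EssentiallySmall.exists_small_le.{v} P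
  let e := equivShrink.{v} (Σ n m : Subtype Q, n.1 ⟶ m.1)
  let j (i : Shrink.{v} (Σ n m : Subtype Q, n.1 ⟶ m.1)) : Arrow C :=
    Arrow.mk (e.symm i).2.2
  obtain ⟨T, hT⟩ := exists_monad_detecting_injectives (fun i ↦ purityArrow (j i))
    fun i ↦ isSequentiallySmall_arrow (hQP _ (e.symm i).1.2) (hQP _ (e.symm i).2.1.2)
  refine ⟨T, fun f ↦ (hT f).trans ⟨fun h n m hn hm u r s w ↦ ?_, fun h i r ↦ ?_⟩⟩
  · obtain ⟨n', hn', ⟨a⟩⟩ := hPQ n hn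
    obtain ⟨m', hm', ⟨b⟩⟩ := hPQ m hm
    have h' (x : Σ n m : Subtype Q, n.1 ⟶ m.1) (r' : Arrow.mk x.2.2 ⟶ f) :
        ∃ d : x.2.1.1 ⟶ f.left, x.2.2 ≫ d = r'.left := by
      obtain ⟨i, rfl⟩ := e.symm.surjective x
      exact (exists_purityArrow_comp_eq_iff r').1 (h i r')
    obtain ⟨d, hd⟩ := h' ⟨⟨n', hn'⟩, ⟨m', hm'⟩, a.inv ≫ u ≫ b.hom⟩
      (Arrow.homMk (a.inv ≫ r) (b.inv ≫ s) (by simp [w]))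
    refine ⟨b.hom ≫ d, ?_⟩
    have hd' : (a.inv ≫ u ≫ b.hom) ≫ d = a.inv ≫ r := hd
    rw [Category.assoc, Category.assoc] at hd'
    exact (cancel_epi a.inv).1 hd'
  · exact (exists_purityArrow_comp_eq_iff r).2
      (h _ _ (hQP _ (e.symm i).1.2) (hQP _ (e.symm i).2.1.2) _ r.left r.right r.w)
end
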